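/- Let 𝓐 ⊆ 𝓛 be the set of all equations of the form (1.1) which have no singular periodic solutions. Then 𝓐 is open in the normed space 𝓛, and any two equations lying in the same path component of 𝓐 have the same number of periodic solutions counted with multiplicity. -/

import Mathlib

open Set Real Filter Topology

noncomputable section

/-- The space `𝓛` of equations (1.1): tuples `P = (P_0, …, P_{n-1})` of continuous
real functions on `[0, ω]`, with the sup norm (coming from the norm on `C([0,ω], ℝ)`
and the sup norm on the finite product). -/
abbrev LSpace (n : ℕ) (ω : ℝ) := Fin n → C(Icc (0:ℝ) ω, ℝ)

/-- The `i`-th coefficient of `P ∈ 𝓛`, as a function on `ℝ` (via `projIcc`). -/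
def coeff {n : ℕ} {ω : ℝ} (hω : 0 ≤ ω) (P : LSpace n ω) (i : Fin n) (t : ℝ) : ℝ :=
  P i (projIcc 0 ω hω t)

/-- Right-hand side of equation (1.1) attached to `P ∈ 𝓛`. -/
def rhsC {n : ℕ} {ω : ℝ} (hω : 0 ≤ ω) (P : LSpace n ω) (t : ℝ) (z : ℂ) : ℂ :=
  z ^ n + ∑ i : Fin n, (coeff hω P i t : ℂ) * z ^ (i : ℕ)

/-- `z` is a (complex-valued) solution of the equation `P` on all of `[0, ω]`. -/
def IsSolC {n : ℕ} {ω : ℝ} (hω : 0 ≤ ω) (P : LSpace n ω) (z : ℝ → ℂ) : Prop :=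
  ∀ t ∈ Icc (0:ℝ) ω, HasDerivWithinAt z (rhsC hω P t (z t)) (Icc (0:ℝ) ω) t

/-- `z` is a periodic solution of `P`. -/
def IsPeriodicC {n : ℕ} {ω : ℝ} (hω : 0 ≤ ω) (P : LSpace n ω) (z : ℝ → ℂ) : Prop :=
  IsSolC hω P z ∧ z ω = z 0

/-- `P` has a singular periodic solution: there are equations `P_j → P` and zeros
`c_j` of the displacement functions of `P_j` such that either `c_j → c` and the
solution of `P` starting at `c` fails to be defined on all of `[0, ω]`, or
`c_j → ∞`. -/
def HasSingularPeriodicSol {n : ℕ} {ω : ℝ} (hω : 0 ≤ ω) (P : LSpace n ω) : Prop :=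
  ∃ (Pj : ℕ → LSpace n ω) (cj : ℕ → ℂ),
    Tendsto Pj atTop (𝓝 P) ∧
    (∀ j, ∃ z : ℝ → ℂ, IsPeriodicC hω (Pj j) z ∧ z 0 = cj j) ∧
    ((∃ c : ℂ, Tendsto cj atTop (𝓝 c) ∧ ¬ ∃ z : ℝ → ℂ, IsSolC hω P z ∧ z 0 = c) ∨
      Tendsto (fun j => ‖cj j‖) atTop atTop)

open Classical in
/-- The displacement function of `P`: `q(P, c) = z_P(ω, c) - c` (junk value `0`
when the solution starting at `c` does not exist on all of `[0, ω]`). -/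
def disp {n : ℕ} {ω : ℝ} (hω : 0 ≤ ω) (P : LSpace n ω) (c : ℂ) : ℂ :=
  if h : ∃ z : ℝ → ℂ, IsSolC hω P z ∧ z 0 = c then h.choose ω - c else 0

/-- `q` has a zero of order exactly `k` at `c`. -/
def HasZeroOfOrder (q : ℂ → ℂ) (c : ℂ) (k : ℕ) : Prop :=
  ∃ g : ℂ → ℂ, AnalyticAt ℂ g c ∧ g c ≠ 0 ∧ ∀ᶠ w in nhds c, q w = (w - c) ^ k * g w

/-- `P` has exactly `N` periodic solutions counted with multiplicity. -/
def PeriodicCount {n : ℕ} {ω : ℝ} (hω : 0 ≤ ω) (P : LSpace n ω) (N : ℕ) : Prop :=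
  ∃ (S : Finset ℂ) (mult : ℂ → ℕ),
    (∀ c : ℂ, c ∈ S ↔ ∃ z : ℝ → ℂ, IsPeriodicC hω P z ∧ z 0 = c) ∧
    (∀ c ∈ S, 1 ≤ mult c ∧ HasZeroOfOrder (disp hω P) c (mult c)) ∧
    ∑ c ∈ S, mult c = N

namespace PolynomialODE

variable {n : ℕ} {ω : ℝ}

lemma hasDerivAt_integral_projIcc (hω : 0 ≤ ω) (f : C(Icc (0 : ℝ) ω, ℂ)) (t : ℝ) :
    HasDerivAt (fun u : ℝ => ∫ s in (0 : ℝ)..u, f (projIcc 0 ω hω s)) (f (projIcc 0 ω hω t)) t := by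
  have hc : Continuous fun s : ℝ => f (projIcc 0 ω hω s) := f.continuous.comp continuous_projIcc
  exact (hc.integral_hasStrictDerivAt 0 t).hasDerivAt

/-- The Volterra integration operator `f ↦ (t ↦ ∫ s in 0..t, f s)` on `C([0, ω], ℂ)`. -/
def volterra (hω : 0 ≤ ω) : C(Icc (0 : ℝ) ω, ℂ) →L[ℂ] C(Icc (0 : ℝ) ω, ℂ) :=
  LinearMap.mkContinuous
    { toFun := fun f =>
        ⟨fun t => ∫ s in (0 : ℝ)..t, f (projIcc 0 ω hω s), by
          have h : Continuous fun u : ℝ => ∫ s in (0 : ℝ)..u, f (projIcc 0 ω hω s) :=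
            continuous_iff_continuousAt.2 fun t =>
              (hasDerivAt_integral_projIcc hω f t).continuousAt
          exact h.comp continuous_subtype_val⟩
      map_add' := fun f g => by
        ext t
        have h (f : C(Icc (0 : ℝ) ω, ℂ)) : Continuous fun s : ℝ => f (projIcc 0 ω hω s) :=
          f.continuous.comp continuous_projIcc
        exact intervalIntegral.integral_add ((h f).intervalIntegrable _ _)
          ((h g).intervalIntegrable _ _)
      map_smul' := fun c f => by
        ext t
        exact intervalIntegral.integral_const_mul c _ }
    ω fun f => by
      refine (ContinuousMap.norm_le _ (by positivity)).2 fun t => ?_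
      have h := intervalIntegral.norm_integral_le_of_norm_le_const (a := (0 : ℝ)) (b := t)
        (f := fun s => f (projIcc 0 ω hω s)) (C := ‖f‖) fun s _ => f.norm_coe_le_norm _
      refine h.trans ?_
      rw [sub_zero, abs_of_nonneg t.2.1, mul_comm]
      exact mul_le_mul_of_nonneg_right t.2.2 (norm_nonneg f)

lemma volterra_apply (hω : 0 ≤ ω) (f : C(Icc (0 : ℝ) ω, ℂ)) (t : Icc (0 : ℝ) ω) :
    volterra hω f t = ∫ s in (0 : ℝ)..t, f (projIcc 0 ω hω s) := rfl

lemma eq_add_volterra_of_hasDerivWithinAt (hω : 0 ≤ ω) {z : ℝ → ℂ} {g : C(Icc (0 : ℝ) ω, ℂ)}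
    (h : ∀ t ∈ Icc (0 : ℝ) ω, HasDerivWithinAt z (g (projIcc 0 ω hω t)) (Icc 0 ω) t)
    (t : Icc (0 : ℝ) ω) : z t = z 0 + volterra hω g t := by
  have hV := hasDerivAt_integral_projIcc hω g
  have hd (s : ℝ) (hs : s ∈ Icc (0 : ℝ) ω) := (h s hs).sub (hV s).hasDerivWithinAt
  have key := constant_of_has_deriv_right_zero (fun s hs => (hd s hs).continuousWithinAt)
    (fun s hs => by
      have := (hd s (Ico_subset_Icc_self hs)).mono_of_mem_nhdsWithin
        (Icc_mem_nhdsGE_of_mem hs)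
      simpa using this) t t.2
  simp only [Pi.sub_apply, intervalIntegral.integral_same, sub_zero] at key
  rw [volterra_apply, ← key, sub_add_cancel]

/-- Linear Volterra equations of the second kind are uniquely solvable. -/
lemma bijective_sub_volterra_mul (hω : 0 ≤ ω) (a : C(Icc (0 : ℝ) ω, ℂ)) :
    Function.Bijective fun h : C(Icc (0 : ℝ) ω, ℂ) => h - volterra hω (a * h) := by
  have hA := hasDerivAt_integral_projIcc hω a
  set A : ℝ → ℂ := fun u => ∫ s in (0 : ℝ)..u, a (projIcc 0 ω hω s)
  constructor
  · intro h₁ h₂ h12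
    have hz : h₁ - h₂ = volterra hω (a * (h₁ - h₂)) := by
      rw [mul_sub, map_sub]
      simp only at h12
      linear_combination (exp := 1) h12
    set h := h₁ - h₂
    have hB := hasDerivAt_integral_projIcc hω (a * h)
    have hval (t : ℝ) (ht : t ∈ Icc (0 : ℝ) ω) :
        (∫ s in (0 : ℝ)..t, (a * h) (projIcc 0 ω hω s)) = h (projIcc 0 ω hω t) := by
      rw [projIcc_of_mem hω ht]
      conv_rhs => rw [hz]
      rfl
    have key := eq_add_volterra_of_hasDerivWithinAt hω (g := 0)
      (z := fun t => Complex.exp (-A t) * ∫ s in (0 : ℝ)..t, (a * h) (projIcc 0 ω hω s))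
      (fun t ht => by
        refine (((hA t).neg.cexp).mul (hB t)).hasDerivWithinAt.congr_deriv ?_
        rw [hval t ht]
        simp only [ContinuousMap.mul_apply, ContinuousMap.zero_apply]
        ring)
    suffices h = 0 from sub_eq_zero.1 this
    ext t
    have := key t
    rw [hval t t.2] at this
    simpa [Complex.exp_ne_zero] using this
  · intro v
    let e : C(Icc (0 : ℝ) ω, ℂ) := ⟨fun t => Complex.exp (-volterra hω a t), by fun_prop⟩
    have hB := hasDerivAt_integral_projIcc hω (e * (a * v))
    let u : C(Icc (0 : ℝ) ω, ℂ) :=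
      ⟨fun t => Complex.exp (volterra hω a t) * volterra hω (e * (a * v)) t, by fun_prop⟩
    have key := eq_add_volterra_of_hasDerivWithinAt hω (g := a * (u + v))
      (z := fun t => Complex.exp (A t) * ∫ s in (0 : ℝ)..t, (e * (a * v)) (projIcc 0 ω hω s))
      (fun t ht => by
        refine (((hA t).cexp).mul (hB t)).hasDerivWithinAt.congr_deriv ?_
        rw [projIcc_of_mem hω ht]
        have h1 : Complex.exp (A t) * Complex.exp (-A t) = 1 := by
          rw [← Complex.exp_add, add_neg_cancel, Complex.exp_zero]
        simp only [ContinuousMap.mul_apply, ContinuousMap.add_apply, ContinuousMap.coe_mk,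
          volterra_apply, u, e]
        change _ * _ * _ + _ * (Complex.exp (-A t) * _) = _ * (Complex.exp (A t) * _ + _)
        linear_combination (a ⟨t, ht⟩ * v ⟨t, ht⟩) * h1)
    refine ⟨u + v, ?_⟩
    have hu : u = volterra hω (a * (u + v)) := by
      ext t
      have := key t
      simp only [intervalIntegral.integral_same, mul_zero, zero_add] at this
      rw [← this]
      rfl
    change u + v - volterra hω (a * (u + v)) = v
    rw [← hu, add_sub_cancel_left]

/-- The polynomial vector field with coefficients `Q`, evaluated along the curve `y`. -/
def field (Q : Fin n → C(Icc (0 : ℝ) ω, ℂ)) (y : C(Icc (0 : ℝ) ω, ℂ)) : C(Icc (0 : ℝ) ω, ℂ) :=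
  y ^ n + ∑ i : Fin n, Q i * y ^ (i : ℕ)

/-- The defect in the integral form of the initial value problem: for `p = ((Q, c), y)` it vanishes
iff `y` solves the equation with coefficients `Q` and `y 0 = c`. -/
def residual (hω : 0 ≤ ω)
    (p : ((Fin n → C(Icc (0 : ℝ) ω, ℂ)) × ℂ) × C(Icc (0 : ℝ) ω, ℂ)) : C(Icc (0 : ℝ) ω, ℂ) :=
  p.2 - p.1.2 • (1 : C(Icc (0 : ℝ) ω, ℂ)) - volterra hω (field p.1.1 p.2)

lemma exists_field_sub_eq_mul (Q : Fin n → C(Icc (0 : ℝ) ω, ℂ)) (x y : C(Icc (0 : ℝ) ω, ℂ)) :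
    ∃ a, field Q x - field Q y = a * (x - y) := by
  have h : x - y ∣ field Q x - field Q y := by
    unfold field
    rw [add_sub_add_comm, ← Finset.sum_sub_distrib]
    refine dvd_add (sub_dvd_pow_sub_pow _ _ _) (Finset.dvd_sum fun i _ => ?_)
    rw [← mul_sub]
    exact (sub_dvd_pow_sub_pow _ _ _).mul_left _
  obtain ⟨a, ha⟩ := h
  exact ⟨a, ha.trans (mul_comm _ _)⟩

lemma residual_unique (hω : 0 ≤ ω) {q : (Fin n → C(Icc (0 : ℝ) ω, ℂ)) × ℂ}
    {x y : C(Icc (0 : ℝ) ω, ℂ)} (hx : residual hω (q, x) = 0) (hy : residual hω (q, y) = 0) :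
    x = y := by
  obtain ⟨a, ha⟩ := exists_field_sub_eq_mul q.1 x y
  refine sub_eq_zero.1 ((bijective_sub_volterra_mul hω a).1 ?_)
  simp only [residual] at hx hy
  simp only [← ha, map_sub, mul_zero, map_zero]
  linear_combination (exp := 1) hx - hy

lemma contDiff_residual (hω : 0 ≤ ω) : ContDiff ℂ 1 (residual (n := n) hω) := by
  unfold residual field
  fun_prop

lemma hasFDerivAt_residual_snd (hω : 0 ≤ ω) (q : (Fin n → C(Icc (0 : ℝ) ω, ℂ)) × ℂ)
    (y : C(Icc (0 : ℝ) ω, ℂ)) :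
    ∃ a : C(Icc (0 : ℝ) ω, ℂ), HasFDerivAt (fun x => residual hω (q, x))
      (ContinuousLinearMap.id ℂ _ - (volterra hω) ∘L (ContinuousLinearMap.mul ℂ _ a)) y := by
  have hpow (k : ℕ) : HasFDerivAt (𝕜 := ℂ) (fun x : C(Icc (0 : ℝ) ω, ℂ) => x ^ k)
      (ContinuousLinearMap.mul ℂ _ (k • y ^ (k - 1))) y := by
    refine (hasFDerivAt_id y).pow k |>.congr_fderiv ?_
    ext1 h
    simp
  refine ⟨n • y ^ (n - 1) + ∑ i : Fin n, q.1 i * ((i : ℕ) • y ^ ((i : ℕ) - 1)), ?_⟩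
  have hf : HasFDerivAt (𝕜 := ℂ) (field q.1) (ContinuousLinearMap.mul ℂ _
      (n • y ^ (n - 1) + ∑ i : Fin n, q.1 i * ((i : ℕ) • y ^ ((i : ℕ) - 1)))) y := by
    refine ((hpow n).add (HasFDerivAt.fun_sum fun (i : Fin n) _ => (hpow i).const_mul (q.1 i))).congr_fderiv ?_
    ext1 h
    simp [mul_assoc]
  exact ((hasFDerivAt_id y).sub_const (q.2 • (1 : C(Icc (0 : ℝ) ω, ℂ)))).sub ((volterra hω).hasFDerivAt.comp y hf)

/-- Smooth dependence of solutions on the coefficients and on the initial value. -/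
lemma exists_contDiffAt_solution (hω : 0 ≤ ω) {q : (Fin n → C(Icc (0 : ℝ) ω, ℂ)) × ℂ}
    {y : C(Icc (0 : ℝ) ω, ℂ)} (h : residual hω (q, y) = 0) :
    ∃ ψ : (Fin n → C(Icc (0 : ℝ) ω, ℂ)) × ℂ → C(Icc (0 : ℝ) ω, ℂ),
      ContDiffAt ℂ 1 ψ q ∧ ∀ᶠ x in 𝓝 q, residual hω (x, ψ x) = 0 := by
  have hF : ContDiffAt ℂ 1 (residual hω) (q, y) := (contDiff_residual hω).contDiffAt
  have hinv : (fderiv ℂ (residual hω) (q, y) ∘L .inr ℂ _ _).IsInvertible := by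
    obtain ⟨a, ha⟩ := hasFDerivAt_residual_snd hω q y
    have h1 := (hF.differentiableAt one_ne_zero).hasFDerivAt.comp y
      (hasFDerivAt_prodMk_right q y)
    rw [h1.unique ha]
    have hb : Function.Bijective (ContinuousLinearMap.id ℂ C(Icc (0 : ℝ) ω, ℂ) -
        (volterra hω) ∘L (ContinuousLinearMap.mul ℂ _ a)) := bijective_sub_volterra_mul hω a
    exact ⟨ContinuousLinearEquiv.ofBijective _ (LinearMap.ker_eq_bot.2 hb.1)
      (LinearMap.range_eq_top.2 hb.2), ContinuousLinearEquiv.coe_ofBijective _ _ _⟩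
  refine ⟨hF.implicitFunction one_ne_zero hinv, hF.contDiffAt_implicitFunction one_ne_zero hinv, ?_⟩
  simpa only [h] using hF.eventually_apply_implicitFunction one_ne_zero hinv

/-- Complexification of the coefficient tuple of an equation. -/
def toComplex (P : LSpace n ω) : Fin n → C(Icc (0 : ℝ) ω, ℂ) :=
  fun i => (⟨Complex.ofReal, Complex.continuous_ofReal⟩ : C(ℝ, ℂ)).comp (P i)

lemma continuous_toComplex : Continuous (toComplex (n := n) (ω := ω)) :=
  continuous_pi fun i => (ContinuousMap.continuous_postcomp _).comp (continuous_apply i)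

lemma field_toComplex_apply (hω : 0 ≤ ω) (P : LSpace n ω) (y : C(Icc (0 : ℝ) ω, ℂ)) (t : ℝ) :
    field (toComplex P) y (projIcc 0 ω hω t) = rhsC hω P t (y (projIcc 0 ω hω t)) := by
  simp [field, rhsC, coeff, toComplex]

lemma isSolC_of_residual_eq_zero (hω : 0 ≤ ω) {P : LSpace n ω} {c : ℂ}
    {y : C(Icc (0 : ℝ) ω, ℂ)} (h : residual hω ((toComplex P, c), y) = 0) :
    IsSolC hω P (fun t => y (projIcc 0 ω hω t)) ∧ y (projIcc 0 ω hω 0) = c := by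
  have hy (t : ℝ) (ht : t ∈ Icc (0 : ℝ) ω) : y (projIcc 0 ω hω t) =
      c + ∫ s in (0 : ℝ)..t, field (toComplex P) y (projIcc 0 ω hω s) := by
    have := DFunLike.congr_fun h ⟨t, ht⟩
    simp only [residual, ContinuousMap.sub_apply, volterra_apply, ContinuousMap.smul_apply,
      ContinuousMap.one_apply, smul_eq_mul, mul_one, ContinuousMap.zero_apply] at this
    rw [projIcc_of_mem hω ht]
    linear_combination this
  refine ⟨fun t ht => ?_, ?_⟩
  · rw [← field_toComplex_apply]
    exact ((hasDerivAt_integral_projIcc hω (field (toComplex P) y) t).const_add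
      c).hasDerivWithinAt.congr hy (hy t ht)
  · simpa using hy 0 ⟨le_rfl, hω⟩

lemma exists_residual_eq_zero_of_isSolC (hω : 0 ≤ ω) {P : LSpace n ω} {z : ℝ → ℂ}
    (h : IsSolC hω P z) :
    ∃ y : C(Icc (0 : ℝ) ω, ℂ),
      (∀ t : Icc (0 : ℝ) ω, y t = z t) ∧ residual hω ((toComplex P, z 0), y) = 0 := by
  have hz : ContinuousOn z (Icc 0 ω) := fun t ht => (h t ht).continuousWithinAt
  let y : C(Icc (0 : ℝ) ω, ℂ) := ⟨(Icc 0 ω).domRestrict z, hz.domRestrict⟩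
  refine ⟨y, fun t => rfl, ?_⟩
  ext t
  have key := eq_add_volterra_of_hasDerivWithinAt hω (z := z) (g := field (toComplex P) y)
    (fun t ht => by
      rw [field_toComplex_apply, projIcc_of_mem hω ht]
      exact h t ht) t
  change z t - z 0 * 1 - volterra hω (field (toComplex P) y) t = 0
  rw [key]
  ring

/-- The pairs `(P, c)` such that the solution of `P` starting at `c` exists on `[0, ω]`. -/
def flowDomain (n : ℕ) (hω : 0 ≤ ω) : Set (LSpace n ω × ℂ) :=
  {p | ∃ z : ℝ → ℂ, IsSolC hω p.1 z ∧ z 0 = p.2}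

/-- The pairs `(P, c)` such that `P` has a periodic solution starting at `c`. -/
def periodicSet (n : ℕ) (hω : 0 ≤ ω) : Set (LSpace n ω × ℂ) :=
  {p | ∃ z : ℝ → ℂ, IsPeriodicC hω p.1 z ∧ z 0 = p.2}

lemma disp_eq_of_isSolC (hω : 0 ≤ ω) {P : LSpace n ω} {z : ℝ → ℂ} (hz : IsSolC hω P z) :
    disp hω P (z 0) = z ω - z 0 := by
  have h : ∃ z' : ℝ → ℂ, IsSolC hω P z' ∧ z' 0 = z 0 := ⟨z, hz, rfl⟩
  rw [disp, dif_pos h]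
  obtain ⟨y, hy, hy0⟩ := exists_residual_eq_zero_of_isSolC hω hz
  obtain ⟨y', hy', hy0'⟩ := exists_residual_eq_zero_of_isSolC hω h.choose_spec.1
  rw [h.choose_spec.2] at hy0'
  have hω' : ω ∈ Icc (0 : ℝ) ω := ⟨hω, le_rfl⟩
  rw [← hy' ⟨ω, hω'⟩, ← hy ⟨ω, hω'⟩, residual_unique hω hy0 hy0']

lemma mem_periodicSet_iff (hω : 0 ≤ ω) {P : LSpace n ω} {c : ℂ} :
    (P, c) ∈ periodicSet n hω ↔ (P, c) ∈ flowDomain n hω ∧ disp hω P c = 0 := by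
  constructor
  · rintro ⟨z, ⟨hz, hp⟩, rfl⟩
    exact ⟨⟨z, hz, rfl⟩, by rw [disp_eq_of_isSolC hω hz, hp, sub_self]⟩
  · rintro ⟨⟨z, hz, rfl⟩, h⟩
    rw [disp_eq_of_isSolC hω hz] at h
    exact ⟨z, ⟨hz, sub_eq_zero.1 h⟩, rfl⟩

lemma exists_contDiffAt_eventually_disp_eq (hω : 0 ≤ ω) {P : LSpace n ω} {c : ℂ}
    (h : (P, c) ∈ flowDomain n hω) :
    ∃ φ : (Fin n → C(Icc (0 : ℝ) ω, ℂ)) × ℂ → ℂ, ContDiffAt ℂ 1 φ (toComplex P, c) ∧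
      ∀ᶠ p in 𝓝 (P, c), p ∈ flowDomain n hω ∧ disp hω p.1 p.2 = φ (toComplex p.1, p.2) := by
  obtain ⟨z, hz, rfl⟩ := h
  obtain ⟨y, -, hy⟩ := exists_residual_eq_zero_of_isSolC hω hz
  obtain ⟨ψ, hψ, hev⟩ := exists_contDiffAt_solution hω hy
  have hω' : ω ∈ Icc (0 : ℝ) ω := ⟨hω, le_rfl⟩
  refine ⟨fun x => ContinuousMap.evalCLM ℂ (⟨ω, hω'⟩ : Icc (0 : ℝ) ω) (ψ x) - x.2, ?_, ?_⟩
  · exact ((ContinuousLinearMap.contDiff _).contDiffAt.comp _ hψ).sub contDiffAt_snd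
  · have hc : Tendsto (fun p : LSpace n ω × ℂ => (toComplex p.1, p.2)) (𝓝 (P, z 0))
        (𝓝 (toComplex P, z 0)) :=
      ((continuous_toComplex.comp continuous_fst).prodMk continuous_snd).continuousAt
    filter_upwards [hc.eventually hev] with p hp
    obtain ⟨hs, h0⟩ := isSolC_of_residual_eq_zero hω hp
    refine ⟨⟨_, hs, h0⟩, ?_⟩
    have := disp_eq_of_isSolC hω hs
    simp only [h0] at this
    rw [this, projIcc_of_mem hω hω']
    rfl

lemma isOpen_flowDomain (hω : 0 ≤ ω) : IsOpen (flowDomain n hω) := by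
  refine isOpen_iff_mem_nhds.2 fun p hp => ?_
  obtain ⟨φ, -, h⟩ := exists_contDiffAt_eventually_disp_eq hω (P := p.1) (c := p.2) hp
  exact h.mono fun _ hx => hx.1

lemma continuousAt_disp (hω : 0 ≤ ω) {P : LSpace n ω} {c : ℂ} (h : (P, c) ∈ flowDomain n hω) :
    ContinuousAt (fun p : LSpace n ω × ℂ => disp hω p.1 p.2) (P, c) := by
  obtain ⟨φ, hφ, h⟩ := exists_contDiffAt_eventually_disp_eq hω h
  have hc : ContinuousAt (fun p : LSpace n ω × ℂ => (toComplex p.1, p.2)) (P, c) :=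
    ((continuous_toComplex.comp continuous_fst).prodMk continuous_snd).continuousAt
  exact (ContinuousAt.comp (f := fun p : LSpace n ω × ℂ => (toComplex p.1, p.2))
    hφ.continuousAt hc).congr (h.mono fun _ hx => hx.2.symm)

lemma isOpen_flowDomain_section (hω : 0 ≤ ω) (P : LSpace n ω) :
    IsOpen {c | (P, c) ∈ flowDomain n hω} :=
  (isOpen_flowDomain hω).preimage (Continuous.prodMk_right P)

lemma differentiableAt_disp (hω : 0 ≤ ω) {P : LSpace n ω} {c : ℂ}
    (h : (P, c) ∈ flowDomain n hω) : DifferentiableAt ℂ (disp hω P) c := by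
  obtain ⟨φ, hφ, h⟩ := exists_contDiffAt_eventually_disp_eq hω h
  have hd : DifferentiableAt ℂ (fun w => φ (toComplex P, w)) c :=
    (hφ.differentiableAt one_ne_zero).comp c
      ((differentiableAt_const _).prodMk differentiableAt_id)
  exact hd.congr_of_eventuallyEq (((Continuous.prodMk_right P).continuousAt.eventually h).mono
    fun _ hx => hx.2)

lemma analyticAt_disp (hω : 0 ≤ ω) {P : LSpace n ω} {c : ℂ}
    (h : (P, c) ∈ flowDomain n hω) : AnalyticAt ℂ (disp hω P) c :=
  DifferentiableOn.analyticAt (s := {c | (P, c) ∈ flowDomain n hω})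
    (fun _ hw => (differentiableAt_disp hω hw).differentiableWithinAt)
    ((isOpen_flowDomain_section hω P).mem_nhds h)

/-- An analytic function with finitely many zeros, counted with multiplicity, equals a polynomial
times a nonvanishing analytic function. -/
lemma exists_analyticAt_eq_prod_mul {f : ℂ → ℂ} {K : Set ℂ} (hf : ∀ w ∈ K, AnalyticAt ℂ f w)
    {S : Finset ℂ} {m : ℂ → ℕ} (hS : ∀ s ∈ S, HasZeroOfOrder f s (m s))
    (hne : ∀ w ∈ K, w ∉ S → f w ≠ 0) :
    ∃ G : ℂ → ℂ, (∀ w ∈ K, AnalyticAt ℂ G w ∧ G w ≠ 0) ∧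
      ∀ w ∉ S, f w = (∏ s ∈ S, (w - s) ^ m s) * G w := by
  classical
  choose! g hg hg0 hfg using hS
  have hprod (T : Finset ℂ) (w : ℂ) (hw : w ∉ T) : ∏ s ∈ T, (w - s) ^ m s ≠ 0 :=
    Finset.prod_ne_zero_iff.2 fun s hs => pow_ne_zero _ (sub_ne_zero.2 fun h => hw (h ▸ hs))
  have hprodA (T : Finset ℂ) (w : ℂ) : AnalyticAt ℂ (fun w => ∏ s ∈ T, (w - s) ^ m s) w := by
    fun_prop
  let G : ℂ → ℂ := fun w => if w ∈ S then g w w / ∏ s ∈ S.erase w, (w - s) ^ m s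
    else f w / ∏ s ∈ S, (w - s) ^ m s
  refine ⟨G, fun w hw => ?_, fun w hw => ?_⟩
  · by_cases hwS : w ∈ S
    · have hw' : w ∉ S.erase w := Finset.notMem_erase w S
      have hG : G =ᶠ[𝓝 w] fun u => g w u / ∏ s ∈ S.erase w, (u - s) ^ m s := by
        have hev : ∀ᶠ u in 𝓝 w, u ∉ S.erase w :=
          (S.erase w).finite_toSet.isClosed.isOpen_compl.mem_nhds hw'
        filter_upwards [hev, hfg w hwS] with u hu hfu
        by_cases huw : u = w
        · subst huw
          simp [G, hwS]
        · have huS : u ∉ S := fun h => hu (Finset.mem_erase.2 ⟨huw, h⟩)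
          have h1 := pow_ne_zero (m w) (sub_ne_zero.2 huw)
          simp only [G, huS, if_false]
          rw [hfu, ← Finset.mul_prod_erase S _ hwS, mul_div_mul_left _ _ h1]
      refine ⟨((hg w hwS).div (hprodA _ w) (hprod _ w hw')).congr hG.symm, ?_⟩
      rw [hG.self_of_nhds]
      exact div_ne_zero (hg0 w hwS) (hprod _ w hw')
    · have hG : G =ᶠ[𝓝 w] fun u => f u / ∏ s ∈ S, (u - s) ^ m s := by
        have hev : ∀ᶠ u in 𝓝 w, u ∉ S := S.finite_toSet.isClosed.isOpen_compl.mem_nhds hwS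
        filter_upwards [hev] with u hu
        simp [G, hu]
      refine ⟨((hf w hw).div (hprodA _ w) (hprod _ w hwS)).congr hG.symm, ?_⟩
      rw [hG.self_of_nhds]
      exact div_ne_zero (hne w hw hwS) (hprod _ w hwS)
  · simp only [G, hw, if_false]
    rw [mul_div_cancel₀ _ (hprod _ w hw)]

/-- The argument principle for a function without poles on a disc. -/
lemma circleIntegral_logDeriv_eq_sum {f : ℂ → ℂ} {c : ℂ} {R : ℝ} (hR : 0 ≤ R)
    (hf : ∀ w ∈ Metric.closedBall c R, AnalyticAt ℂ f w) {S : Finset ℂ} {m : ℂ → ℕ}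
    (hSb : ∀ s ∈ S, s ∈ Metric.ball c R) (hS : ∀ s ∈ S, HasZeroOfOrder f s (m s))
    (hne : ∀ w ∈ Metric.closedBall c R, w ∉ S → f w ≠ 0) :
    (∮ z in C(c, R), logDeriv f z) = 2 * π * Complex.I * ((∑ s ∈ S, m s : ℕ) : ℂ) := by
  obtain ⟨G, hG, hfG⟩ := exists_analyticAt_eq_prod_mul hf hS hne
  have hsphere (z : ℂ) (hz : z ∈ Metric.sphere c R) : z ∉ S := fun h =>
    Metric.sphere_disjoint_ball.le_bot ⟨hz, hSb z h⟩
  have hlog (z : ℂ) (hz : z ∈ Metric.sphere c R) :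
      logDeriv f z = (∑ s ∈ S, (m s : ℂ) * (z - s)⁻¹) + logDeriv G z := by
    have hzS := hsphere z hz
    obtain ⟨hGa, hG0⟩ := hG z (Metric.sphere_subset_closedBall hz)
    have hev : f =ᶠ[𝓝 z] fun w => (∏ s ∈ S, (w - s) ^ m s) * G w :=
      Filter.mem_of_superset (S.finite_toSet.isClosed.isOpen_compl.mem_nhds hzS) hfG
    have hs (s : ℂ) (hs : s ∈ S) : z - s ≠ 0 := sub_ne_zero.2 fun h => hzS (h ▸ hs)
    rw [(logDeriv_congr_nhds hev).self_of_nhds, logDeriv_mul z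
      (Finset.prod_ne_zero_iff.2 fun s h => pow_ne_zero _ (hs s h)) hG0 (by fun_prop)
      hGa.differentiableAt, logDeriv_prod (f := fun s w : ℂ => (w - s) ^ m s)
      (fun s h => pow_ne_zero _ (hs s h))
      (fun s _ => by fun_prop)]
    congr 1
    refine Finset.sum_congr rfl fun s _ => ?_
    rw [logDeriv_fun_pow (by fun_prop), logDeriv_apply]
    simp
  have hint (s : ℂ) (hs : s ∈ S) : CircleIntegrable (fun z => (m s : ℂ) * (z - s)⁻¹) c R := by
    refine ContinuousOn.circleIntegrable hR fun z hz => ContinuousAt.continuousWithinAt ?_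
    have : z - s ≠ 0 := sub_ne_zero.2 fun h => hsphere z hz (h ▸ hs)
    fun_prop (disch := assumption)
  have hGd : DifferentiableOn ℂ (logDeriv G) (Metric.closedBall c R) := fun z hz =>
    ((hG z hz).1.deriv.differentiableAt.div (hG z hz).1.differentiableAt
      (hG z hz).2).differentiableWithinAt
  have hG0 : (∮ z in C(c, R), logDeriv G z) = 0 :=
    (hGd.mono Metric.closure_ball_subset_closedBall).diffContOnCl.circleIntegral_eq_zero hR
  rw [circleIntegral.integral_congr hR hlog, circleIntegral.integral_add
    (CircleIntegrable.fun_sum S hint)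
    ((hGd.continuousOn.mono Metric.sphere_subset_closedBall).circleIntegrable hR), hG0, add_zero,
    circleIntegral.integral_fun_sum hint, Nat.cast_sum, Finset.mul_sum]
  refine Finset.sum_congr rfl fun s hs => ?_
  rw [circleIntegral.integral_const_mul, circleIntegral.integral_sub_inv_of_mem_ball (hSb s hs),
    mul_comm]

/-- Rouché's theorem on a disc. -/
lemma sum_order_eq_of_norm_sub_lt {f g : ℂ → ℂ} {c : ℂ} {R : ℝ} (hR : 0 ≤ R)
    (hf : ∀ w ∈ Metric.closedBall c R, AnalyticAt ℂ f w)
    (hg : ∀ w ∈ Metric.closedBall c R, AnalyticAt ℂ g w)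
    (hfg : ∀ w ∈ Metric.sphere c R, ‖g w - f w‖ < ‖f w‖)
    {S T : Finset ℂ} {k m : ℂ → ℕ}
    (hSb : ∀ s ∈ S, s ∈ Metric.ball c R) (hS : ∀ s ∈ S, HasZeroOfOrder f s (k s))
    (hSne : ∀ w ∈ Metric.closedBall c R, w ∉ S → f w ≠ 0)
    (hTb : ∀ s ∈ T, s ∈ Metric.ball c R) (hT : ∀ s ∈ T, HasZeroOfOrder g s (m s))
    (hTne : ∀ w ∈ Metric.closedBall c R, w ∉ T → g w ≠ 0) :
    ∑ s ∈ S, k s = ∑ s ∈ T, m s := by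
  have hf0 (w : ℂ) (hw : w ∈ Metric.sphere c R) : f w ≠ 0 := fun h => by
    have := hfg w hw
    rw [h, norm_zero] at this
    exact (norm_nonneg _).not_gt this
  have hg0 (w : ℂ) (hw : w ∈ Metric.sphere c R) : g w ≠ 0 := fun h => by
    have := hfg w hw
    rw [h, zero_sub, norm_neg] at this
    exact this.false
  have hci {h : ℂ → ℂ} (ha : ∀ w ∈ Metric.closedBall c R, AnalyticAt ℂ h w)
      (h0 : ∀ w ∈ Metric.sphere c R, h w ≠ 0) : CircleIntegrable (logDeriv h) c R := by
    refine ContinuousOn.circleIntegrable hR fun z hz => ContinuousAt.continuousWithinAt ?_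
    have := ha z (Metric.sphere_subset_closedBall hz)
    exact this.deriv.continuousAt.div this.continuousAt (h0 z hz)
  have hzero : (∮ z in C(c, R), (logDeriv g z - logDeriv f z)) = 0 := by
    refine circleIntegral.integral_eq_zero_of_hasDerivWithinAt hR
      (f := fun z => Complex.log (g z / f z)) fun z hz => ?_
    have hz' := Metric.sphere_subset_closedBall hz
    have hslit : g z / f z ∈ Complex.slitPlane := by
      have h1 : g z / f z = 1 + (g z - f z) / f z := by
        field_simp [hf0 z hz]
        ring
      rw [h1]
      refine Complex.mem_slitPlane_of_norm_lt_one ?_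
      rw [norm_div, div_lt_one (norm_pos_iff.2 (hf0 z hz))]
      exact hfg z hz
    have hd := (((hg z hz').differentiableAt.hasDerivAt.div (hf z hz').differentiableAt.hasDerivAt
      (hf0 z hz)).clog hslit)
    refine (hd.congr_deriv ?_).hasDerivWithinAt
    have := hf0 z hz
    have := hg0 z hz
    rw [logDeriv_apply, logDeriv_apply, Pi.div_apply]
    field_simp
  rw [circleIntegral.integral_sub (hci hg hg0) (hci hf hf0),
    circleIntegral_logDeriv_eq_sum hR hf hSb hS hSne,
    circleIntegral_logDeriv_eq_sum hR hg hTb hT hTne, sub_eq_zero] at hzero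
  exact_mod_cast (mul_left_cancel₀ Complex.two_pi_I_ne_zero hzero).symm

lemma not_hasSingularPeriodicSol_iff (hω : 0 ≤ ω) {P : LSpace n ω} :
    ¬ HasSingularPeriodicSol hω P ↔
      (∃ R : ℝ, ∀ᶠ P' in 𝓝 P, ∀ c, (P', c) ∈ periodicSet n hω → ‖c‖ ≤ R) ∧
      ∀ c, (P, c) ∈ closure (periodicSet n hω) → (P, c) ∈ flowDomain n hω := by
  constructor
  · intro h
    constructor
    · by_contra! hR
      have hex (j : ℕ) : ∃ Q c, dist Q P < 1 / ((j : ℝ) + 1) ∧ (Q, c) ∈ periodicSet n hω ∧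
          (j : ℝ) < ‖c‖ := by
        obtain ⟨Q, ⟨c, hc, hjc⟩, hQ⟩ :=
          ((hR j).and_eventually (Metric.ball_mem_nhds P (Nat.one_div_pos_of_nat (n := j)))).exists
        exact ⟨Q, c, hQ, hc, hjc⟩
      choose Q c hQ hc hjc using hex
      exact h ⟨Q, c, tendsto_iff_dist_tendsto_zero.2 (squeeze_zero (fun _ => dist_nonneg)
        (fun j => (hQ j).le) tendsto_one_div_add_atTop_nhds_zero_nat), hc,
        Or.inr (tendsto_atTop_mono (fun j => (hjc j).le) tendsto_natCast_atTop_atTop)⟩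
    · intro c hc
      by_contra hcD
      obtain ⟨x, hx, hxc⟩ := mem_closure_iff_seq_limit.1 hc
      exact h ⟨fun j => (x j).1, fun j => (x j).2, (continuous_fst.tendsto _).comp hxc, hx,
        Or.inl ⟨c, (continuous_snd.tendsto _).comp hxc, hcD⟩⟩
  · rintro ⟨⟨R, hR⟩, hD⟩ ⟨Q, c, hQ, hc, ⟨c₀, hc₀, hnot⟩ | hinf⟩
    · exact hnot (hD c₀ (mem_closure_of_tendsto (hQ.prodMk_nhds hc₀) (Eventually.of_forall hc)))
    · obtain ⟨j, hj, hj'⟩ := ((hQ.eventually hR).and (hinf.eventually_gt_atTop R)).exists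
      exact (hj _ (hc j)).not_gt hj'

lemma isOpen_not_hasSingularPeriodicSol (hω : 0 ≤ ω) :
    IsOpen {P : LSpace n ω | ¬ HasSingularPeriodicSol hω P} := by
  refine isOpen_iff_mem_nhds.2 fun P hP => ?_
  obtain ⟨⟨R, hR⟩, hD⟩ := (not_hasSingularPeriodicSol_iff hω).1 hP
  have hopen : IsOpen (closure (periodicSet n hω) \ flowDomain n hω)ᶜ :=
    (isClosed_closure.sdiff (isOpen_flowDomain hω)).isOpen_compl
  have hcpt : ∀ᶠ P' in 𝓝 P, ∀ c ∈ Metric.closedBall (0 : ℂ) R,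
      (P', c) ∈ (closure (periodicSet n hω) \ flowDomain n hω)ᶜ :=
    (isCompact_closedBall 0 R).eventually_forall_of_forall_eventually
      (P := fun P' c => (P', c) ∈ (closure (periodicSet n hω) \ flowDomain n hω)ᶜ)
      fun c _ => hopen.mem_nhds fun hc => hc.2 (hD c hc.1)
  filter_upwards [eventually_eventually_nhds.2 hR, hcpt] with P' hR' hcpt'
  refine (not_hasSingularPeriodicSol_iff hω).2 ⟨⟨R, hR'⟩, fun c hc => ?_⟩
  have hcR : ‖c‖ ≤ R := by
    have hev : ∀ᶠ p in 𝓝 (P', c), p ∈ periodicSet n hω → ‖p.2‖ ≤ R :=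
      (continuousAt_fst.eventually hR').mono fun p hp => hp p.2
    have hfr := (mem_closure_iff_frequently.1 hc).and_eventually hev
    exact (isClosed_le (continuous_norm.comp continuous_snd) continuous_const :
      IsClosed {p : LSpace n ω × ℂ | ‖p.2‖ ≤ R}).mem_of_frequently_of_tendsto
      (hfr.mono fun p hp => hp.2 hp.1) tendsto_id
  by_contra hcD
  exact hcpt' c (mem_closedBall_zero_iff.2 hcR) ⟨hc, hcD⟩

lemma mem_periodicSet_of_mem_closure (hω : 0 ≤ ω) {P : LSpace n ω} {c : ℂ}
    (hD : (P, c) ∈ flowDomain n hω) (hc : (P, c) ∈ closure (periodicSet n hω)) :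
    (P, c) ∈ periodicSet n hω := by
  refine (mem_periodicSet_iff hω).2 ⟨hD, ?_⟩
  exact isClosed_singleton.mem_of_frequently_of_tendsto
    ((mem_closure_iff_frequently.1 hc).mono fun p hp => ((mem_periodicSet_iff hω).1 hp).2)
    (continuousAt_disp hω hD)

/-- An equation without singular periodic solutions has finitely many periodic solutions, each of
finite multiplicity. -/
lemma exists_periodicCount (hω : 0 ≤ ω) {P : LSpace n ω} (hP : ¬ HasSingularPeriodicSol hω P) :
    ∃ N, PeriodicCount hω P N := by
  obtain ⟨⟨R, hR⟩, hD⟩ := (not_hasSingularPeriodicSol_iff hω).1 hP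
  set Z : Set ℂ := {c | (P, c) ∈ periodicSet n hω} with hZ
  have hZR : Z ⊆ Metric.closedBall 0 R := fun c hc =>
    mem_closedBall_zero_iff.2 (hR.self_of_nhds c hc)
  have hZD (c : ℂ) (hc : c ∈ Z) : (P, c) ∈ flowDomain n hω := ((mem_periodicSet_iff hω).1 hc).1
  have hZc : IsClosed Z := by
    have : Z = Prod.mk P ⁻¹' closure (periodicSet n hω) :=
      Subset.antisymm (fun c hc => subset_closure hc)
        fun c hc => mem_periodicSet_of_mem_closure hω (hD c hc) hc
    rw [this]
    exact isClosed_closure.preimage (Continuous.prodMk_right P)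
  have hnot (c : ℂ) (hc : c ∈ Z) : ∀ᶠ w in 𝓝[≠] c, disp hω P w ≠ 0 := by
    have hdich (w : ℂ) (hw : w ∈ Z) :=
      (analyticAt_disp hω (hZD w hw)).eventually_eq_zero_or_eventually_ne_zero
    refine (hdich c hc).resolve_left fun h0 => ?_
    have hmem (w : ℂ) (hw : w ∈ Z) (h : ∀ᶠ u in 𝓝 w, disp hω P u = 0) : w ∈ interior Z := by
      rw [mem_interior_iff_mem_nhds]
      filter_upwards [h, (isOpen_flowDomain_section hω P).mem_nhds (hZD w hw)] with u hu huD
      exact (mem_periodicSet_iff hω).2 ⟨huD, hu⟩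
    have hclosed : IsClosed (interior Z) := by
      refine isClosed_of_closure_subset fun w hw => ?_
      have hwZ : w ∈ Z := closure_minimal interior_subset hZc hw
      refine hmem w hwZ ((hdich w hwZ).resolve_right fun hne => ?_)
      by_cases hwi : w ∈ interior Z
      · have h1 : ∀ᶠ u in 𝓝[≠] w, u ∈ Z :=
          nhdsWithin_le_nhds (mem_interior_iff_mem_nhds.1 hwi)
        obtain ⟨u, hu, hu'⟩ := (h1.and hne).exists
        exact hu' ((mem_periodicSet_iff hω).1 hu).2
      · obtain ⟨u, hu, hu'⟩ := ((mem_closure_iff_frequently.1 hw).and_eventually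
          (eventually_nhdsWithin_iff.1 hne)).exists
        have huZ : u ∈ Z := interior_subset hu
        exact hu' (fun h => hwi (h ▸ hu)) ((mem_periodicSet_iff hω).1 huZ).2
    have huniv : interior Z = univ :=
      IsClopen.eq_univ ⟨hclosed, isOpen_interior⟩ ⟨c, hmem c hc h0⟩
    have hb : Bornology.IsBounded (univ : Set ℂ) :=
      Metric.isBounded_closedBall.subset (huniv ▸ interior_subset.trans hZR)
    exact NormedSpace.unbounded_univ ℂ ℂ hb
  have hfin : Z.Finite := by
    by_contra hinf
    obtain ⟨c, -, hc⟩ := Set.Infinite.exists_accPt_of_subset_isCompact hinf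
      (isCompact_closedBall 0 R) hZR
    have hcZ : c ∈ Z := hZc.closure_eq ▸ mem_closure_iff_clusterPt.2 hc.clusterPt
    obtain ⟨w, hw, hw'⟩ := ((accPt_iff_frequently_nhdsNE.1 hc).and_eventually (hnot c hcZ)).exists
    exact hw' ((mem_periodicSet_iff hω).1 hw).2
  have hord (c : ℂ) (hc : c ∈ Z) : ∃ k : ℕ, 1 ≤ k ∧ HasZeroOfOrder (disp hω P) c k := by
    have hfr : ¬ ∀ᶠ w in 𝓝 c, disp hω P w = 0 := fun h => by
      have h' : ∀ᶠ w in 𝓝[≠] c, disp hω P w = 0 := nhdsWithin_le_nhds h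
      obtain ⟨w, hw, hw'⟩ := (h'.and (hnot c hc)).exists
      exact hw' hw
    obtain ⟨k, g, hg, hg0, heq⟩ :=
      (analyticAt_disp hω (hZD c hc)).exists_eventuallyEq_pow_smul_nonzero_iff.2 hfr
    refine ⟨k, Nat.one_le_iff_ne_zero.2 fun hk => ?_, g, hg, hg0, heq⟩
    have := heq.self_of_nhds
    rw [((mem_periodicSet_iff hω).1 hc).2, hk, pow_zero, one_smul] at this
    exact hg0 this.symm
  choose! m hm using hord
  exact ⟨_, hfin.toFinset, m, fun c => hfin.mem_toFinset,
    fun c hc => hm c (hfin.mem_toFinset.1 hc), rfl⟩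

lemma exists_pos_forall_closedBall_subset {S : Finset ℂ} {U : Set ℂ} (hU : IsOpen U)
    (hS : ∀ s ∈ S, s ∈ U) :
    ∃ r > 0, (∀ s ∈ S, Metric.closedBall s r ⊆ U) ∧
      ∀ s ∈ S, ∀ t ∈ S, s ≠ t → Disjoint (Metric.closedBall s r) (Metric.closedBall t r) := by
  have h1 : ∀ᶠ r in 𝓝[>] (0 : ℝ), ∀ s ∈ S, Metric.closedBall s r ⊆ U :=
    nhdsWithin_le_nhds ((Finset.eventually_all S).2 fun s hs =>
      eventually_closedBall_subset (hU.mem_nhds (hS s hs)))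
  have h2 : ∀ᶠ r in 𝓝[>] (0 : ℝ), ∀ s ∈ S, ∀ t ∈ S, s ≠ t → r + r < dist s t := by
    refine nhdsWithin_le_nhds ((Finset.eventually_all S).2 fun s _ =>
      (Finset.eventually_all S).2 fun t _ => ?_)
    by_cases hst : s = t
    · simp [hst]
    · have : Tendsto (fun r : ℝ => r + r) (𝓝 0) (𝓝 (0 + 0)) := tendsto_id.add tendsto_id
      rw [add_zero] at this
      exact (this.eventually_lt_const (dist_pos.2 hst)).mono fun r hr _ => hr
  obtain ⟨r, hr, h1, h2⟩ := (eventually_mem_nhdsWithin.and (h1.and h2)).exists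
  exact ⟨r, hr, h1, fun s hs t ht hst =>
    Metric.closedBall_disjoint_closedBall (h2 s hs t ht hst)⟩

/-- The number of periodic solutions is locally constant where there are no singular ones. -/
lemma eventually_periodicCount_eq (hω : 0 ≤ ω) {P : LSpace n ω}
    (hP : ¬ HasSingularPeriodicSol hω P) {N : ℕ} (hN : PeriodicCount hω P N) :
    ∀ᶠ P' in 𝓝 P, ∀ N', PeriodicCount hω P' N' → N' = N := by
  classical
  obtain ⟨⟨R, hR⟩, hD⟩ := (not_hasSingularPeriodicSol_iff hω).1 hP
  obtain ⟨S, k, hS, hk, rfl⟩ := hN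
  replace hS (c : ℂ) : c ∈ S ↔ (P, c) ∈ periodicSet n hω := hS c
  obtain ⟨r, hr, hrD, hrS⟩ := exists_pos_forall_closedBall_subset
    (isOpen_flowDomain_section hω P) fun s hs => ((mem_periodicSet_iff hω).1 ((hS s).1 hs)).1
  have hzero (s : ℂ) (hs : s ∈ S) (w : ℂ) (hw : w ∈ Metric.closedBall s r) (hws : w ≠ s) :
      disp hω P w ≠ 0 := fun h0 => by
    have hwS : w ∈ S := (hS w).2 ((mem_periodicSet_iff hω).2 ⟨hrD s hs hw, h0⟩)
    exact (hrS w hwS s hs hws).le_bot ⟨Metric.mem_closedBall_self hr.le, hw⟩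
  have hdom : ∀ᶠ P' in 𝓝 P, ∀ s ∈ S, ∀ w ∈ Metric.closedBall s r, (P', w) ∈ flowDomain n hω :=
    (Finset.eventually_all S).2 fun s hs =>
      (isCompact_closedBall s r).eventually_forall_of_forall_eventually
        (P := fun P' w => (P', w) ∈ flowDomain n hω)
        fun w hw => (isOpen_flowDomain hω).mem_nhds (hrD s hs hw)
  have hlt : ∀ᶠ P' in 𝓝 P, ∀ s ∈ S, ∀ w ∈ Metric.sphere s r,
      ‖disp hω P' w - disp hω P w‖ < ‖disp hω P w‖ := by
    refine (Finset.eventually_all S).2 fun s hs =>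
      (isCompact_sphere s r).eventually_forall_of_forall_eventually
        (P := fun P' w => ‖disp hω P' w - disp hω P w‖ < ‖disp hω P w‖) fun w hw => ?_
    have hw' := Metric.sphere_subset_closedBall hw
    have hc : ContinuousAt (fun p : LSpace n ω × ℂ => disp hω P p.2) (P, w) :=
      ContinuousAt.comp (f := Prod.snd) (g := disp hω P)
        (differentiableAt_disp hω (hrD s hs hw')).continuousAt continuousAt_snd
    refine ((continuousAt_disp hω (hrD s hs hw')).sub hc).norm.eventually_lt hc.norm ?_
    simpa using hzero s hs w hw' (Metric.ne_of_mem_sphere hw hr.ne')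
  have hfar : ∀ᶠ P' in 𝓝 P, ∀ c ∈ Metric.closedBall (0 : ℂ) R \ ⋃ s ∈ S, Metric.ball s r,
      (P', c) ∈ (closure (periodicSet n hω))ᶜ := by
    refine ((isCompact_closedBall 0 R).diff (isOpen_biUnion fun s _ =>
      Metric.isOpen_ball)).eventually_forall_of_forall_eventually
        (P := fun P' c => (P', c) ∈ (closure (periodicSet n hω))ᶜ)
        fun c hc => isClosed_closure.isOpen_compl.mem_nhds fun hcl => hc.2 ?_
    have hcS := (hS c).2 (mem_periodicSet_of_mem_closure hω (hD c hcl) hcl)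
    exact mem_biUnion hcS (Metric.mem_ball_self hr)
  filter_upwards [hR, hdom, hlt, hfar] with P' hR' hdom' hlt' hfar' N' hN'
  obtain ⟨T, m, hT, hm, rfl⟩ := hN'
  replace hT (c : ℂ) : c ∈ T ↔ (P', c) ∈ periodicSet n hω := hT c
  have hTU : T = S.biUnion fun s => T.filter (· ∈ Metric.ball s r) := by
    ext c
    simp only [Finset.mem_biUnion, Finset.mem_filter]
    refine ⟨fun hc => ?_, fun ⟨s, _, hc, _⟩ => hc⟩
    have hcP := (hT c).1 hc
    by_contra! hcon
    refine hfar' c ⟨mem_closedBall_zero_iff.2 (hR' c hcP), fun hcU => ?_⟩ (subset_closure hcP)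
    obtain ⟨s, hs, hcs⟩ := mem_iUnion₂.1 hcU
    exact hcon s hs hc hcs
  have hdisj : (S : Set ℂ).PairwiseDisjoint fun s => T.filter (· ∈ Metric.ball s r) :=
    fun s hs t ht hst => Finset.disjoint_left.2 fun c hc hc' =>
      (hrS s hs t ht hst).le_bot ⟨Metric.ball_subset_closedBall (Finset.mem_filter.1 hc).2,
        Metric.ball_subset_closedBall (Finset.mem_filter.1 hc').2⟩
  rw [hTU, Finset.sum_biUnion hdisj]
  refine Finset.sum_congr rfl fun s hs => ?_
  rw [← Finset.sum_singleton k s]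
  refine (sum_order_eq_of_norm_sub_lt hr.le (fun w hw => analyticAt_disp hω (hrD s hs hw))
    (fun w hw => analyticAt_disp hω (hdom' s hs w hw)) (hlt' s hs) ?_ ?_ ?_ ?_ ?_ ?_).symm
  · simpa using hr
  · simpa using (hk s hs).2
  · exact fun w hw hws => hzero s hs w hw (by simpa using hws)
  · exact fun t ht => (Finset.mem_filter.1 ht).2
  · exact fun t ht => (hm t (Finset.mem_filter.1 ht).1).2
  · intro w hw hwT h0
    have hwb : w ∈ Metric.ball s r := by
      refine Metric.mem_ball.2 ((Metric.mem_closedBall.1 hw).lt_of_ne fun hws => ?_)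
      have := hlt' s hs w hws
      rw [h0, zero_sub, norm_neg] at this
      exact this.false
    exact hwT (Finset.mem_filter.2
      ⟨(hT w).2 ((mem_periodicSet_iff hω).2 ⟨hdom' s hs w hw, h0⟩), hwb⟩)

lemma periodicCount_eq_of_joinedIn (hω : 0 ≤ ω) {P P' : LSpace n ω}
    (h : JoinedIn {P : LSpace n ω | ¬ HasSingularPeriodicSol hω P} P P') {N N' : ℕ}
    (hN : PeriodicCount hω P N) (hN' : PeriodicCount hω P' N') : N = N' := by
  obtain ⟨γ, hγ⟩ := h
  choose count hcount using fun t => exists_periodicCount hω (hγ t)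
  have hloc : IsLocallyConstant count := (IsLocallyConstant.iff_eventually_eq count).2 fun t =>
    (γ.continuous.continuousAt.eventually
      (eventually_periodicCount_eq hω (hγ t) (hcount t))).mono fun s hs => hs _ (hcount s)
  have h0 : N = count 0 :=
    (eventually_periodicCount_eq hω (hγ 0) (hcount 0)).self_of_nhds N (by simpa using hN)
  have h1 : N' = count 1 :=
    (eventually_periodicCount_eq hω (hγ 1) (hcount 1)).self_of_nhds N' (by simpa using hN')
  rw [h0, h1, hloc.apply_eq_of_preconnectedSpace 0 1]

end PolynomialODE

/-- Lemma 2.1(i): the set `𝓐` of equations with no singular periodic solutions is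
open in `𝓛`, and any two equations in the same path component of `𝓐` have the same
number of periodic solutions counted with multiplicity. -/
theorem no_singular_set_open_and_count_locally_constant
    {n : ℕ} (hn : 2 ≤ n) {ω : ℝ} (hω : 0 < ω) :
    IsOpen {P : LSpace n ω | ¬ HasSingularPeriodicSol hω.le P} ∧
    ∀ P P' : LSpace n ω,
      ¬ HasSingularPeriodicSol hω.le P → ¬ HasSingularPeriodicSol hω.le P' →
      JoinedIn {P : LSpace n ω | ¬ HasSingularPeriodicSol hω.le P} P P' →
      ∀ N N' : ℕ, PeriodicCount hω.le P N → PeriodicCount hω.le P' N' → N = N' := by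
  exact ⟨PolynomialODE.isOpen_not_hasSingularPeriodicSol hω.le, fun _ _ _ _ h _ _ hN hN' =>
    PolynomialODE.periodicCount_eq_of_joinedIn hω.le h hN hN'⟩
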